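/- Let d ≥ 1 and let A be a finite nonempty subset of ℤ^d such that the difference set A − A generates ℤ^d as an additive group. Then there exist a polynomial p ∈ ℚ[x] of degree exactly d and a natural number H such that |hA| = p(h) for every natural number h ≥ H, and moreover the coefficient of x^d in p equals vol(Δ_A), the d-dimensional Lebesgue measure of the convex hull Δ_A of A in ℝ^d. -/

import Mathlib

open Pointwise MeasureTheory

/-- The `h`-fold sumset `hA` of a set `A` in an additive commutative monoid:
`0A = {0}` and `(n+1)A = A + nA`. -/
def iterSumset {G : Type*} [AddCommMonoid G] (A : Set G) : ℕ → Set G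
  | 0 => {0}
  | n + 1 => A + iterSumset A n

theorem mem_iterSumset_range {G : Type*} [AddCommMonoid G] {k : ℕ} (a : Fin k → G) (h : ℕ) (x : G) :
    x ∈ iterSumset (Set.range a) h ↔ ∃ c : Fin k → ℕ, ∑ i, c i = h ∧ ∑ i, c i • a i = x := by
  induction h generalizing x with
  | zero =>
    simp only [iterSumset, Set.mem_singleton_iff]
    constructor
    · rintro rfl
      exact ⟨0, by simp, by simp⟩
    · rintro ⟨c, hc, rfl⟩
      have : ∀ i, c i = 0 := by simpa using hc
      simp [this]
  | succ n ih =>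
    simp only [iterSumset, Set.mem_add, Set.mem_range]
    constructor
    · rintro ⟨_, ⟨j, rfl⟩, y, hy, rfl⟩
      obtain ⟨c, hc, rfl⟩ := (ih y).1 hy
      refine ⟨Pi.single j 1 + c, ?_, ?_⟩
      · simp [Finset.sum_add_distrib, hc, add_comm]
      · simp [Finset.sum_add_distrib, add_smul, Pi.single_apply, ite_smul]
    · rintro ⟨c, hc, rfl⟩
      have : ∃ j, c j ≠ 0 := by
        by_contra! hcon
        simp [hcon] at hc
      obtain ⟨j, hj⟩ := this
      have hcj : c = Pi.single j 1 + (c - Pi.single j 1) := by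
        ext i
        by_cases hi : i = j
        · subst hi; simp; omega
        · simp [hi]
      refine ⟨a j, ⟨j, rfl⟩, ∑ i, (c - Pi.single j 1 : Fin k → ℕ) i • a i, (ih _).2 ⟨_, ?_, rfl⟩, ?_⟩
      · rw [hcj] at hc
        simp only [Pi.add_apply, Finset.sum_add_distrib] at hc
        simp at hc
        simp only [Pi.sub_apply]
        omega
      · conv_rhs => rw [hcj]
        simp [Finset.sum_add_distrib, add_smul, Pi.single_apply, ite_smul]

/-- Eventually polynomial functions. -/
def EvPoly (f : ℕ → ℕ) : Prop := ∃ p : Polynomial ℚ, ∃ H : ℕ, ∀ h, H ≤ h → (f h : ℚ) = p.eval (h : ℚ)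

theorem finite_tot {k : ℕ} (h : ℕ) : {x : Fin k → ℕ | ∑ i, x i = h}.Finite := by
  refine (Set.finite_Iic (fun _ : Fin k => h)).subset ?_
  intro x hx i
  rw [← show ∑ i, x i = h from hx]
  exact Finset.single_le_sum (f := x) (fun _ _ => Nat.zero_le _) (Finset.mem_univ i)

theorem evPoly_base (k : ℕ) : EvPoly (fun h => {x : Fin k → ℕ | ∑ i, x i = h}.ncard) := by
  have key : ∀ h, {x : Fin k → ℕ | ∑ i, x i = h}.ncard = k.multichoose h := by
    intro h
    have := Finset.card_finsuppAntidiag_nat_eq_multichoose (s := (Finset.univ : Finset (Fin k))) h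
    rw [Finset.card_univ, Fintype.card_fin] at this
    rw [← this, ← Set.ncard_coe_finset]
    refine Set.ncard_congr (fun x _ => Finsupp.equivFunOnFinite.symm x) ?_ ?_ ?_
    · intro x hx
      simpa using hx
    · intro x y _ _ hxy
      simpa using hxy
    · intro y hy
      refine ⟨y, ?_, by ext; simp⟩
      simpa using hy
  rcases k with _ | k
  · refine ⟨0, 1, fun h hh => ?_⟩
    simp only [key]
    obtain ⟨m, rfl⟩ : ∃ m, h = m + 1 := ⟨h - 1, by omega⟩
    simp
  · refine ⟨Polynomial.preHilbertPoly ℚ k 0, 0, fun h _ => ?_⟩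
    simp only [key]
    rw [Polynomial.preHilbertPoly_eq_choose_sub_add ℚ k (Nat.zero_le h), Nat.multichoose_eq]
    have : k + 1 + h - 1 = h + k := by omega
    rw [this, Nat.sub_zero, Nat.choose_symm_add]

theorem evPoly_avoid {k : ℕ} (n : ℕ) : ∀ M : List (Fin k → ℕ), M.length = n →
    EvPoly (fun h => {x : Fin k → ℕ | ∑ i, x i = h ∧ ∀ m ∈ M, ¬ m ≤ x}.ncard) := by
  induction n with
  | zero =>
    intro M hM
    obtain rfl := List.length_eq_zero_iff.1 hM
    simpa using evPoly_base k
  | succ n ih =>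
    intro M' hM'
    obtain ⟨m, M, rfl⟩ : ∃ m M, M' = m :: M := by
      cases M' with
      | nil => simp at hM'
      | cons m M => exact ⟨m, M, rfl⟩
    have hM : M.length = n := by simpa using hM'
    obtain ⟨p, H, hp⟩ := ih M hM
    obtain ⟨q, K, hq⟩ := ih (M.map (fun m' => m' - m)) (by simpa using hM)
    set c := ∑ i, m i with hc
    refine ⟨p - q.comp (Polynomial.X - Polynomial.C (c : ℚ)), H + K + c, fun h hh => ?_⟩
    have e1 := hp h (by omega)
    have e2 := hq (h - c) (by omega)
    have hcast : ((h - c : ℕ) : ℚ) = (h : ℚ) - c := by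
      rw [Nat.cast_sub (by omega)]
    simp only [Polynomial.eval_sub, Polynomial.eval_comp, Polynomial.eval_X, Polynomial.eval_C]
    rw [← hcast, ← e1, ← e2, eq_sub_iff_add_eq, ← Nat.cast_add]
    congr 1
    set S := {x : Fin k → ℕ | ∑ i, x i = h ∧ ∀ m' ∈ M, ¬ m' ≤ x} with hS
    have hSf : S.Finite := (finite_tot h).subset (fun x hx => hx.1)
    have hT : {x : Fin k → ℕ | ∑ i, x i = h - c ∧ ∀ m' ∈ M.map (fun m' => m' - m), ¬ m' ≤ x}.ncard
        = (S ∩ {x | m ≤ x}).ncard := by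
      refine Set.ncard_congr (fun x _ => x + m) ?_ ?_ ?_
      · rintro x ⟨hx1, hx2⟩
        refine ⟨⟨?_, ?_⟩, ?_⟩
        · simp only [Pi.add_apply, Finset.sum_add_distrib, hx1, ← hc]
          omega
        · intro m' hm' hle
          exact hx2 (m' - m) (List.mem_map.2 ⟨m', hm', rfl⟩) (tsub_le_iff_right.2 hle)
        · exact fun i => Nat.le_add_left _ _
      · intro x y _ _ hxy
        exact add_right_cancel hxy
      · rintro y ⟨⟨hy1, hy2⟩, hy3⟩
        have hy3 : m ≤ y := hy3
        have hym : y - m + m = y := tsub_add_cancel_of_le hy3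
        refine ⟨y - m, ⟨?_, ?_⟩, hym⟩
        · have : ∑ i, (y - m + m) i = h := by rw [hym]; exact hy1
          simp only [Pi.add_apply, Finset.sum_add_distrib, ← hc] at this
          omega
        · intro m'' hm''
          obtain ⟨m', hm', rfl⟩ := List.mem_map.1 hm''
          intro hle
          exact hy2 m' hm' (by rw [← hym]; exact tsub_le_iff_right.1 hle)
    beta_reduce
    rw [hT]
    have hD : {x : Fin k → ℕ | ∑ i, x i = h ∧ ∀ m' ∈ m :: M, ¬ m' ≤ x} = S \ {x | m ≤ x} := by
      ext x
      simp only [List.mem_cons, forall_eq_or_imp, Set.mem_ofPred_eq, Set.mem_sdiff, hS]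
      tauto
    rw [hD, add_comm]
    exact Set.ncard_inter_add_ncard_sdiff_eq_ncard S _ hSf

theorem upper_finite_basis {k : ℕ} (U : Set (Fin k → ℕ)) (hU : IsUpperSet U) :
    ∃ M : List (Fin k → ℕ), ∀ x, x ∈ U ↔ ∃ m ∈ M, m ≤ x := by
  have hf : {x | Minimal (· ∈ U) x}.Finite :=
    WellQuasiOrderedLE.finite_of_isAntichain (setOfPred_minimal_antichain _)
  refine ⟨hf.toFinset.toList, fun x => ?_⟩
  simp only [Finset.mem_toList, Set.Finite.mem_toFinset, Set.mem_ofPred_eq]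
  constructor
  · intro hx
    obtain ⟨m, hm, hmin⟩ := exists_minimal_le_of_wellFoundedLT (· ∈ U) x hx
    exact ⟨m, hmin, hm⟩
  · rintro ⟨m, hm, hle⟩
    exact hU hle hm.prop

theorem khovanskii_poly {G : Type*} [AddCommMonoid G] {k : ℕ} (a : Fin k → G) :
    EvPoly (fun h => (iterSumset (Set.range a) h).ncard) := by
  set φ : (Fin k → ℕ) → G := fun c => ∑ i, c i • a i with hφ
  have hφadd : ∀ x y, φ (x + y) = φ x + φ y := by
    intro x y
    simp [hφ, add_smul, Finset.sum_add_distrib]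
  set U : Set (Fin k → ℕ) :=
    {x | ∃ y : Fin k → ℕ, ∑ i, y i = ∑ i, x i ∧ φ y = φ x ∧ toLex y < toLex x} with hUdef
  have hU : IsUpperSet U := by
    rintro x x' hle ⟨y, h1, h2, h3⟩
    obtain ⟨z, rfl⟩ : ∃ z, x' = x + z := ⟨x' - x, (add_tsub_cancel_of_le hle).symm⟩
    refine ⟨y + z, ?_, ?_, ?_⟩
    · simp [Finset.sum_add_distrib, h1]
    · simp [hφadd, h2]
    · rw [toLex_add, toLex_add]
      exact add_lt_add_left h3 _
  obtain ⟨M, hM⟩ := upper_finite_basis U hU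
  obtain ⟨p, H, hp⟩ := evPoly_avoid _ M rfl
  refine ⟨p, H, fun h hh => ?_⟩
  rw [← hp h hh]
  congr 1
  symm
  refine Set.ncard_congr (fun x _ => φ x) ?_ ?_ ?_
  · rintro x ⟨hx, _⟩
    exact (mem_iterSumset_range a h _).2 ⟨x, hx, rfl⟩
  · rintro x y ⟨hx, hx'⟩ ⟨hy, hy'⟩ hxy
    have hxU : x ∉ U := by
      rw [hM]; push Not; exact hx'
    have hyU : y ∉ U := by
      rw [hM]; push Not; exact hy'
    rcases lt_trichotomy (toLex x) (toLex y) with hlt | heq | hlt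
    · exact absurd ⟨x, hx.trans hy.symm, hxy, hlt⟩ hyU
    · exact toLex.injective heq
    · exact absurd ⟨y, hy.trans hx.symm, hxy.symm, hlt⟩ hxU
  · intro g hg
    obtain ⟨c, hc1, hc2⟩ := (mem_iterSumset_range a h g).1 hg
    obtain ⟨z, ⟨hz1, hz2⟩, hz3⟩ := (wellFounded_lt (α := Lex (Fin k → ℕ))).has_min
      {z | ∑ i, (ofLex z) i = h ∧ φ (ofLex z) = g} ⟨toLex c, hc1, hc2⟩
    refine ⟨ofLex z, ⟨hz1, ?_⟩, hz2⟩
    have : ofLex z ∉ U := by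
      rintro ⟨y, h1, h2, h3⟩
      exact hz3 (toLex y) ⟨h1.trans hz1, h2.trans hz2⟩ h3
    rw [hM] at this
    push Not at this
    exact this

/-- The coordinatewise embedding of integer vectors into real vectors. -/
def embR {d : ℕ} (v : Fin d → ℤ) : Fin d → ℝ := fun i => (v i : ℝ)

theorem embR_inj {d : ℕ} : Function.Injective (embR (d := d)) := by
  intro x y h
  ext i
  have := congrFun h i
  simpa [embR] using this

theorem embR_sum {d k : ℕ} (c : Fin k → ℤ) (a : Fin k → Fin d → ℤ) :
    embR (∑ i, c i • a i) = ∑ i, (c i : ℝ) • embR (a i) := by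
  ext j
  simp [embR, Finset.sum_apply]

theorem mem_hull_iff {d k : ℕ} (f : Fin k → Fin d → ℝ) (y : Fin d → ℝ) :
    y ∈ convexHull ℝ (Set.range f) ↔
      ∃ w : Fin k → ℝ, (∀ i, 0 ≤ w i) ∧ ∑ i, w i = 1 ∧ ∑ i, w i • f i = y := by
  constructor
  · intro hy
    have hconv : Convex ℝ ((Fintype.linearCombination ℝ f) '' stdSimplex ℝ (Fin k)) :=
      (convex_stdSimplex ℝ (Fin k)).linear_image _
    have hsub : Set.range f ⊆ (Fintype.linearCombination ℝ f) '' stdSimplex ℝ (Fin k) := by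
      rintro _ ⟨i, rfl⟩
      exact ⟨Pi.single i 1, single_mem_stdSimplex ℝ i, by simp⟩
    obtain ⟨w, ⟨h0, h1⟩, h2⟩ := convexHull_min hsub hconv hy
    exact ⟨w, h0, h1, by simpa [Fintype.linearCombination_apply] using h2⟩
  · rintro ⟨w, h0, h1, rfl⟩
    exact (convex_convexHull ℝ _).sum_mem (fun i _ => h0 i) h1
      (fun i _ => subset_convexHull ℝ _ ⟨i, rfl⟩)

theorem gen_zero_sum {d k : ℕ} (a : Fin k → Fin d → ℤ)
    (hgen : AddSubgroup.closure (Set.range a - Set.range a) = ⊤) (u : Fin d → ℤ) :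
    ∃ n : Fin k → ℤ, ∑ i, n i = 0 ∧ ∑ i, n i • a i = u := by
  have hu : u ∈ AddSubgroup.closure (Set.range a - Set.range a) := by rw [hgen]; trivial
  induction hu using AddSubgroup.closure_induction with
  | mem x hx =>
    obtain ⟨_, ⟨i, rfl⟩, _, ⟨j, rfl⟩, rfl⟩ := hx
    refine ⟨Pi.single i 1 - Pi.single j 1, ?_, ?_⟩
    · simp
    · simp [sub_smul, Pi.single_apply, ite_smul]
  | zero => exact ⟨0, by simp, by simp⟩
  | add x y _ _ hx hy =>
    obtain ⟨n, h1, h2⟩ := hx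
    obtain ⟨m, h3, h4⟩ := hy
    exact ⟨n + m, by simp [Finset.sum_add_distrib, h1, h3],
      by simp only [Finset.sum_add_distrib, add_smul, Pi.add_apply, h2, h4]⟩
  | neg x _ hx =>
    obtain ⟨n, h1, h2⟩ := hx
    exact ⟨-n, by simp [h1], by simp only [Pi.neg_apply, neg_smul, Finset.sum_neg_distrib, h2]⟩

theorem gen_sum {d k : ℕ} (a : Fin k → Fin d → ℤ) (i₀ : Fin k)
    (hgen : AddSubgroup.closure (Set.range a - Set.range a) = ⊤) (u : Fin d → ℤ) (s : ℤ) :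
    ∃ n : Fin k → ℤ, ∑ i, n i = s ∧ ∑ i, n i • a i = u := by
  obtain ⟨n, h1, h2⟩ := gen_zero_sum a hgen (u - s • a i₀)
  refine ⟨n + Pi.single i₀ s, ?_, ?_⟩
  · simp [Finset.sum_add_distrib, h1]
  · simp only [Pi.add_apply, Finset.sum_add_distrib, add_smul, h2]
    simp [Pi.single_apply]

theorem core_lower {d k : ℕ} (a : Fin k → Fin d → ℤ) (i₀ : Fin k)
    (hgen : AddSubgroup.closure (Set.range a - Set.range a) = ⊤) :
    ∃ N : ℕ, ∀ (n : ℕ) (v : Fin d → ℤ),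
      (∃ w : Fin k → ℝ, (∀ i, 0 ≤ w i) ∧ ∑ i, w i = n ∧ ∑ i, w i • embR (a i) = embR v) →
      v + ∑ i, N • a i ∈ iterSumset (Set.range a) (n + k * N) := by
  choose f hf1 hf2 using gen_sum a i₀ hgen
  set B : Fin d → ℤ := fun j => ∑ i, |a i j| with hB
  set T : Finset ((Fin d → ℤ) × ℤ) := Finset.Icc (-B) B ×ˢ Finset.Icc 0 (k : ℤ) with hT
  set N : ℕ := ∑ t ∈ T, ∑ i, (f t.1 t.2 i).natAbs with hN
  refine ⟨N, ?_⟩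
  rintro n v ⟨w, hw0, hw1, hw2⟩
  set r : Fin d → ℤ := v - ∑ i, ⌊w i⌋ • a i with hr
  set s : ℤ := n - ∑ i, ⌊w i⌋ with hs
  have hs' : (s : ℝ) = ∑ i, Int.fract (w i) := by
    simp only [hs, Int.fract, Finset.sum_sub_distrib, hw1]
    push_cast
    rfl
  have hr' : ∀ j, (r j : ℝ) = ∑ i, Int.fract (w i) * (a i j : ℝ) := by
    intro j
    have h2 := congrFun hw2 j
    simp only [embR, Finset.sum_apply, Pi.smul_apply, smul_eq_mul] at h2
    simp only [hr, Int.fract, sub_mul, Finset.sum_sub_distrib, Pi.sub_apply, Finset.sum_apply,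
      Pi.smul_apply, smul_eq_mul]
    rw [h2]
    push_cast
    rfl
  have hmem : (r, s) ∈ T := by
    simp only [hT, Finset.mem_product, Finset.mem_Icc]
    have habs : ∀ j, |r j| ≤ B j := by
      intro j
      have : |(r j : ℝ)| ≤ (B j : ℝ) := by
        rw [hr' j]
        refine (Finset.abs_sum_le_sum_abs _ _).trans ?_
        simp only [hB]
        push_cast
        refine Finset.sum_le_sum fun i _ => ?_
        rw [abs_mul, abs_of_nonneg (Int.fract_nonneg _)]
        exact mul_le_of_le_one_left (abs_nonneg _) (Int.fract_lt_one _).le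
      exact_mod_cast this
    refine ⟨⟨fun j => (abs_le.1 (habs j)).1, fun j => (abs_le.1 (habs j)).2⟩, ?_, ?_⟩
    · have : (0 : ℝ) ≤ s := by
        rw [hs']; exact Finset.sum_nonneg fun i _ => Int.fract_nonneg _
      exact_mod_cast this
    · have : (s : ℝ) ≤ k := by
        rw [hs']
        refine (Finset.sum_le_sum (g := fun _ => (1 : ℝ)) fun i _ => (Int.fract_lt_one _).le).trans ?_
        simp
      exact_mod_cast this
  have hfN : ∀ i, (f r s i).natAbs ≤ N := by
    intro i
    calc (f r s i).natAbs ≤ ∑ i, (f r s i).natAbs :=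
          Finset.single_le_sum (f := fun i => (f r s i).natAbs)
            (fun _ _ => Nat.zero_le _) (Finset.mem_univ i)
      _ ≤ N := Finset.single_le_sum (f := fun t : (Fin d → ℤ) × ℤ => ∑ i, (f t.1 t.2 i).natAbs)
            (fun _ _ => Nat.zero_le _) hmem
  have hpos : ∀ i, 0 ≤ ⌊w i⌋ + f r s i + N := by
    intro i
    have h1 := hfN i
    have h2 : 0 ≤ ⌊w i⌋ := Int.floor_nonneg.2 (hw0 i)
    omega
  rw [mem_iterSumset_range]
  refine ⟨fun i => (⌊w i⌋ + f r s i + N).toNat, ?_, ?_⟩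
  · zify
    simp only [Int.toNat_of_nonneg (hpos _), Finset.sum_add_distrib, hf1]
    simp [hs]
  · have : ∀ i, (⌊w i⌋ + f r s i + N).toNat • a i = (⌊w i⌋ + f r s i + (N : ℤ)) • a i := by
      intro i
      rw [← natCast_zsmul, Int.toNat_of_nonneg (hpos i)]
    rw [Finset.sum_congr rfl fun i _ => this i]
    simp only [add_smul, Finset.sum_add_distrib, hf2, natCast_zsmul]
    rw [hr]
    abel

theorem vol_pos {d k : ℕ} (a : Fin k → Fin d → ℤ) (i₀ : Fin k)
    (hgen : AddSubgroup.closure (Set.range a - Set.range a) = ⊤) :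
    (interior (convexHull ℝ (Set.range fun i => embR (a i)))).Nonempty := by
  rw [interior_convexHull_nonempty_iff_affineSpan_eq_top,
    AffineSubspace.affineSpan_eq_top_iff_vectorSpan_eq_top_of_nonempty _ _ _
      (Set.nonempty_of_mem (Set.mem_range_self i₀)),
    eq_top_iff, ← (Pi.basisFun ℝ (Fin d)).span_eq, Submodule.span_le]
  rintro _ ⟨j, rfl⟩
  obtain ⟨n, h1, h2⟩ := gen_zero_sum a hgen (Pi.single j 1)
  have h3 : Pi.basisFun ℝ (Fin d) j = ∑ i, (n i : ℝ) • (embR (a i) - embR (a i₀)) := by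
    have h1' : ∑ i, (n i : ℝ) = 0 := by exact_mod_cast h1
    simp only [smul_sub, Finset.sum_sub_distrib, ← Finset.sum_smul, h1', ← embR_sum, h2]
    ext l
    simp [embR, Pi.single_apply]
  rw [h3]
  refine Submodule.sum_mem _ fun i _ => Submodule.smul_mem _ _ ?_
  exact vsub_mem_vectorSpan ℝ ⟨i, rfl⟩ ⟨i₀, rfl⟩

/-- Lattice points of `n⁻¹ ℤ^d` in the convex hull. -/
def latPts {d k : ℕ} (a : Fin k → Fin d → ℤ) (n : ℕ) : Set (Fin d → ℝ) :=
  convexHull ℝ (Set.range fun i => embR (a i)) ∩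
    (n : ℝ)⁻¹ • (Submodule.span ℤ (Set.range (Pi.basisFun ℝ (Fin d))) : Set (Fin d → ℝ))

theorem mem_latPts {d k : ℕ} (a : Fin k → Fin d → ℤ) (n : ℕ) (hn : 1 ≤ n) (y : Fin d → ℝ) :
    y ∈ latPts a n ↔ y ∈ convexHull ℝ (Set.range fun i => embR (a i)) ∧
      ∃ v : Fin d → ℤ, embR v = (n : ℝ) • y := by
  have : NeZero n := ⟨by omega⟩
  refine and_congr Iff.rfl ?_
  have := BoxIntegral.unitPartition.mem_smul_span_iff (n := n) (v := y)
  rw [← Submodule.coe_pointwise_smul, SetLike.mem_coe, this]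
  constructor
  · intro h
    choose v hv using h
    exact ⟨v, funext fun i => by simpa [embR] using hv i⟩
  · rintro ⟨v, hv⟩ i
    exact ⟨v i, by simpa [embR] using congrFun hv i⟩

theorem finite_iterSumset {G : Type*} [AddCommMonoid G] (A : Set G) (hA : A.Finite) (n : ℕ) :
    (iterSumset A n).Finite := by
  induction n with
  | zero => exact Set.finite_singleton _
  | succ n ih => exact hA.add ih

theorem lower_bound {d k : ℕ} (a : Fin k → Fin d → ℤ) (i₀ : Fin k)
    (hgen : AddSubgroup.closure (Set.range a - Set.range a) = ⊤) :
    ∃ C : ℕ, ∀ n, 1 ≤ n → (latPts a n).Finite ∧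
      (latPts a n).ncard ≤ (iterSumset (Set.range a) (n + C)).ncard := by
  obtain ⟨N, hN⟩ := core_lower a i₀ hgen
  refine ⟨k * N, fun n hn => ?_⟩
  have hn0 : (n : ℝ) ≠ 0 := by positivity
  have hex : ∀ y : Fin d → ℝ, ∃ v : Fin d → ℤ, y ∈ latPts a n → embR v = (n : ℝ) • y := by
    intro y
    by_cases hy : y ∈ latPts a n
    · obtain ⟨v, hv⟩ := ((mem_latPts a n hn y).1 hy).2
      exact ⟨v, fun _ => hv⟩
    · exact ⟨0, fun h => absurd h hy⟩
  choose g hg using hex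
  have hfin := finite_iterSumset (Set.range a) (Set.finite_range a) (n + k * N)
  have hmaps : Set.MapsTo (fun y => g y + ∑ i, N • a i) (latPts a n)
      (iterSumset (Set.range a) (n + k * N)) := by
    intro y hy
    refine hN n (g y) ?_
    obtain ⟨w, h0, h1, h2⟩ := (mem_hull_iff _ y).1 ((mem_latPts a n hn y).1 hy).1
    refine ⟨fun i => n * w i, fun i => mul_nonneg (Nat.cast_nonneg _) (h0 i), ?_, ?_⟩
    · rw [← Finset.mul_sum, h1, mul_one]
    · rw [hg y hy, ← h2, Finset.smul_sum]
      simp only [mul_smul]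
  have hinj : Set.InjOn (fun y => g y + ∑ i, N • a i) (latPts a n) := by
    intro x hx y hy hxy
    have h1 : g x = g y := add_right_cancel hxy
    have h2 : (n : ℝ) • x = (n : ℝ) • y := by rw [← hg x hx, ← hg y hy, h1]
    exact smul_right_injective _ hn0 h2
  exact ⟨Set.Finite.of_injOn hmaps hinj hfin, Set.ncard_le_ncard_of_injOn _ hmaps hinj hfin⟩

theorem upper_bound {d k : ℕ} (a : Fin k → Fin d → ℤ) (n : ℕ) (hn : 1 ≤ n)
    (hf : (latPts a n).Finite) :
    (iterSumset (Set.range a) n).ncard ≤ (latPts a n).ncard := by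
  have hn0 : (n : ℝ) ≠ 0 := by positivity
  refine Set.ncard_le_ncard_of_injOn (fun v => (n : ℝ)⁻¹ • embR v) ?_ ?_ hf
  · intro v hv
    obtain ⟨c, h1, rfl⟩ := (mem_iterSumset_range a n v).1 hv
    refine (mem_latPts a n hn _).2 ⟨(mem_hull_iff _ _).2 ?_, ?_⟩
    · refine ⟨fun i => (n : ℝ)⁻¹ * c i, fun i => by positivity, ?_, ?_⟩
      · rw [← Finset.mul_sum, ← Nat.cast_sum, h1, inv_mul_cancel₀ hn0]
      · have := embR_sum (fun i => (c i : ℤ)) a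
        simp only [natCast_zsmul, Int.cast_natCast] at this
        rw [this, Finset.smul_sum]
        simp only [mul_smul]
    · exact ⟨_, (smul_inv_smul₀ hn0 _).symm⟩
  · intro x _ y _ hxy
    exact embR_inj (smul_right_injective _ (inv_ne_zero hn0) hxy)

open Filter Topology in
theorem tendsto_sumset {d k : ℕ} (a : Fin k → Fin d → ℤ) (i₀ : Fin k)
    (hgen : AddSubgroup.closure (Set.range a - Set.range a) = ⊤) :
    Tendsto (fun n : ℕ => ((iterSumset (Set.range a) n).ncard : ℝ) / (n : ℝ) ^ d) atTop
      (𝓝 (volume.real (convexHull ℝ (Set.range fun i => embR (a i))))) := by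
  set Δ := convexHull ℝ (Set.range fun i => embR (a i)) with hΔ
  have hcomp : IsCompact Δ := (Set.finite_range _).isCompact_convexHull ℝ
  have hL : Tendsto (fun n : ℕ => ((latPts a n).ncard : ℝ) / (n : ℝ) ^ d) atTop
      (𝓝 (volume.real Δ)) := by
    have := tendsto_card_div_pow_atTop_volume Δ hcomp.isBounded hcomp.measurableSet
      ((convex_convexHull ℝ _).addHaar_frontier volume)
    rw [Fintype.card_fin] at this
    exact this
  obtain ⟨C, hC⟩ := lower_bound a i₀ hgen
  have hlow : Tendsto (fun n : ℕ => ((latPts a (n - C)).ncard : ℝ) / (n : ℝ) ^ d) atTop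
      (𝓝 (volume.real Δ)) := by
    rw [← tendsto_add_atTop_iff_nat C]
    have h1 : Tendsto (fun n : ℕ => ((n : ℝ) / ((n : ℝ) + C)) ^ d) atTop (𝓝 1) := by
      simpa using (tendsto_natCast_div_add_atTop (C : ℝ)).pow d
    have h2 := hL.mul h1
    rw [mul_one] at h2
    refine h2.congr' ?_
    filter_upwards [eventually_ge_atTop 1] with n hn
    have hn0 : (n : ℝ) ≠ 0 := by positivity
    have hn1 : (n : ℝ) + C ≠ 0 := by positivity
    rw [Nat.add_sub_cancel]
    push_cast
    rw [div_pow]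
    field_simp
  refine tendsto_of_tendsto_of_tendsto_of_le_of_le' hlow hL ?_ ?_
  · filter_upwards [eventually_ge_atTop (C + 1)] with n hn
    have := (hC (n - C) (by omega)).2
    rw [Nat.sub_add_cancel (by omega)] at this
    gcongr
  · filter_upwards [eventually_ge_atTop 1] with n hn
    have := upper_bound a n hn (hC n hn).1
    gcongr

open Filter Topology in
theorem poly_degree (p : Polynomial ℚ) (d : ℕ) (v : ℝ) (hv : 0 < v)
    (h : Tendsto (fun n : ℕ => ((p.eval (n : ℚ) : ℚ) : ℝ) / (n : ℝ) ^ d) atTop (𝓝 v)) :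
    p.degree = d ∧ (p.coeff d : ℝ) = v := by
  set q : Polynomial ℝ := p.map (algebraMap ℚ ℝ) with hq
  have hdeg : q.degree = p.degree := Polynomial.degree_map _ _
  have hX : (Polynomial.X ^ d : Polynomial ℝ).degree = d := Polynomial.degree_X_pow d
  have hX0 : (Polynomial.X ^ d : Polynomial ℝ) ≠ 0 := pow_ne_zero _ Polynomial.X_ne_zero
  have h' : Tendsto (fun n : ℕ => q.eval (n : ℝ) / (Polynomial.X ^ d : Polynomial ℝ).eval (n : ℝ))
      atTop (𝓝 v) := by
    refine h.congr fun n => ?_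
    have : q.eval (n : ℝ) = ((p.eval (n : ℚ) : ℚ) : ℝ) := by
      rw [hq, Polynomial.eval_natCast_map]
      simp
    rw [this]
    simp
  have hd : p.degree = d := by
    rcases lt_trichotomy q.degree (Polynomial.X ^ d : Polynomial ℝ).degree with hlt | heq | hgt
    · have h0 := (Polynomial.div_tendsto_atTop_zero_of_degree_lt q _ hlt).comp
        (tendsto_natCast_atTop_atTop (R := ℝ))
      exact absurd (tendsto_nhds_unique h' h0) hv.ne'
    · rw [← hdeg, heq, hX]
    · have h0 := (Polynomial.abs_div_tendsto_atTop_atTop_of_degree_gt q _ hgt hX0).comp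
        (tendsto_natCast_atTop_atTop (R := ℝ))
      exact absurd h0 (not_tendsto_atTop_of_tendsto_nhds h'.abs)
  refine ⟨hd, ?_⟩
  have h0 := (Polynomial.div_tendsto_atTop_leadingCoeff_div_of_degree_eq q (Polynomial.X ^ d)
    (by rw [hdeg, hd, hX])).comp (tendsto_natCast_atTop_atTop (R := ℝ))
  have := tendsto_nhds_unique h0 h'
  rw [← this, (Polynomial.monic_X_pow d).leadingCoeff, div_one, Polynomial.leadingCoeff,
    Polynomial.natDegree_eq_of_degree_eq_some (hdeg.trans hd), hq, Polynomial.coeff_map]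
  simp

theorem khovanskii_leading_term (d : ℕ) (hd : 1 ≤ d) (A : Set (Fin d → ℤ))
    (hfin : A.Finite) (hne : A.Nonempty)
    (hgen : AddSubgroup.closure (A - A) = ⊤) :
    ∃ (p : Polynomial ℚ) (H : ℕ), p.degree = d ∧
      ((p.coeff d : ℝ) =
        (volume (convexHull ℝ ((fun (v : Fin d → ℤ) (i : Fin d) => (v i : ℝ)) '' A))).toReal) ∧
      ∀ h : ℕ, H ≤ h → ((iterSumset A h).ncard : ℚ) = p.eval (h : ℚ) := by
  obtain ⟨k, a, -, rfl⟩ := hfin.fin_param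
  obtain ⟨_, ⟨i₀, rfl⟩⟩ := hne
  obtain ⟨p, H, hp⟩ := khovanskii_poly a
  have hset : ((fun (v : Fin d → ℤ) (i : Fin d) => (v i : ℝ)) '' Set.range a)
      = Set.range fun i => embR (a i) := by
    rw [← Set.range_comp]
    rfl
  have hcomp : IsCompact (convexHull ℝ (Set.range fun i => embR (a i))) :=
    (Set.finite_range _).isCompact_convexHull ℝ
  have hpos : 0 < volume.real (convexHull ℝ (Set.range fun i => embR (a i))) :=
    ENNReal.toReal_pos (Measure.measure_pos_of_nonempty_interior _ (vol_pos a i₀ hgen)).ne'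
      hcomp.measure_lt_top.ne
  have hlim := tendsto_sumset a i₀ hgen
  obtain ⟨h1, h2⟩ := poly_degree p d _ hpos (hlim.congr' (by
    filter_upwards [Filter.eventually_ge_atTop H] with n hn
    rw [← hp n hn]
    simp))
  refine ⟨p, H, h1, ?_, hp⟩
  rw [hset, h2]
  rfl
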